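/- arXiv:1207.5440 — 3 statements merged into one kernel-verified Lean document; each statement's English description precedes it below -/
import Mathlib

section
/- Let U ⊆ ℝ³ be a contractible open set and let a, b : U → ℝ be smooth functions. Then the pair of equations X³b = (X²Y + XZ + W)a and Y²a = (YX − Z)b holds on U if and only if there exist a smooth function f : U → ℝ and a constant C ∈ ℝ such that Xf = a and (Yf)(x,y,z) = C·x + b(x,y,z) on U. -/
/-- Martinet operator `X = ∂/∂x` on `ℝ³` with coordinates `(x, y, z)`. -/
noncomputable def opX (f : (Fin 3 → ℝ) → ℝ) : (Fin 3 → ℝ) → ℝ :=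
  fun p => fderiv ℝ f p ![1, 0, 0]

/-- Martinet operator `Y = ∂/∂z + x² ∂/∂y` on `ℝ³`. -/
noncomputable def opY (f : (Fin 3 → ℝ) → ℝ) : (Fin 3 → ℝ) → ℝ :=
  fun p => fderiv ℝ f p ![0, (p 0) ^ 2, 1]

/-- Martinet operator `Z = [X, Y] = 2x ∂/∂y` on `ℝ³`. -/
noncomputable def opZ (f : (Fin 3 → ℝ) → ℝ) : (Fin 3 → ℝ) → ℝ :=
  fun p => fderiv ℝ f p ![0, 2 * p 0, 0]

/-- Martinet operator `W = [X, Z] = 2 ∂/∂y` on `ℝ³`. -/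
noncomputable def opW (f : (Fin 3 → ℝ) → ℝ) : (Fin 3 → ℝ) → ℝ :=
  fun p => fderiv ℝ f p ![0, 2, 0]

open Set Filter Topology

theorem exists_global_of_locally_const_sub {X A : Type*} [TopologicalSpace X]
    [SimplyConnectedSpace X] [LocallyPathConnectedSpace X] [AddCommGroup A]
    (V : X → Set X) (hV : ∀ i, IsOpen (V i)) (hmem : ∀ x, x ∈ V x) (φ : X → X → A)
    (hφ : ∀ i j, ∀ x ∈ V i ∩ V j, ∀ᶠ y in 𝓝 x, φ i y - φ j y = φ i x - φ j x) :
    ∃ f : X → A, ∀ x, ∀ᶠ y in 𝓝 x, f y - φ x y = f x - φ x x := by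
  let : TopologicalSpace A := ⊥
  have : DiscreteTopology A := ⟨rfl⟩
  let Z : FiberBundleCore X X A :=
    { baseSet := V
      isOpen_baseSet := hV
      indexAt := id
      mem_baseSet_at := hmem
      coordChange i j x v := v + (φ i x - φ j x)
      coordChange_self i x _ v := by simp
      continuousOn_coordChange i j := by
        rintro ⟨x, v⟩ ⟨hx, -⟩
        refine ContinuousAt.continuousWithinAt ?_
        have h : (fun p : X × A => p.2 + (φ i p.1 - φ j p.1)) =ᶠ[𝓝 (x, v)]
            fun p => p.2 + (φ i x - φ j x) := by
          filter_upwards [continuous_fst.continuousAt.eventually (hφ i j x hx)] with p hp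
          rw [hp]
        refine ContinuousAt.congr ?_ h.symm
        exact (continuous_of_discreteTopology (f := fun a : A => a + (φ i x - φ j x))).continuousAt.comp
          continuous_snd.continuousAt
      coordChange_comp i j k x _ v := by abel }
  obtain ⟨x₀⟩ : Nonempty X := inferInstance
  have hcov : IsCoveringMap Z.proj := FiberBundle.isCoveringMap (F := A) (E := Z.Fiber)
  obtain ⟨s, ⟨-, hs⟩, -⟩ := hcov.existsUnique_continuousMap_lifts (ContinuousMap.id X) x₀
    (⟨x₀, (0 : A)⟩ : Z.TotalSpace) rfl
  have hs' : ∀ x, (s x).1 = x := fun x => congr_fun hs x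
  let σ : X → A := fun x => (s x).2
  refine ⟨fun x => σ x + φ x x, fun x => ?_⟩
  have hcont : ContinuousAt (fun y => (Z.localTriv x (s y)).2) x := by
    refine continuous_snd.continuousAt.comp (ContinuousAt.comp ?_ s.continuous.continuousAt)
    refine (Z.localTriv x).continuousAt ?_
    rw [Z.mem_localTriv_source, hs']
    exact hmem x
  have hval : ∀ y, (Z.localTriv x (s y)).2 = σ y + (φ y y - φ x y) := fun y => by
    rw [Z.localTriv_apply]
    change σ y + (φ (s y).1 (s y).1 - φ x (s y).1) = _
    rw [hs']
  simp only [hval] at hcont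
  have := hcont.eventually (by rw [nhds_discrete]; exact eventually_pure.2 rfl :
    ∀ᶠ c in 𝓝 (σ x + (φ x x - φ x x)), c = σ x + (φ x x - φ x x))
  filter_upwards [this] with y hy
  rw [add_sub_assoc, hy, add_sub_assoc]

theorem exists_forall_hasFDerivAt_of_simplyConnected {E F : Type*}
    [NormedAddCommGroup E] [NormedSpace ℝ E] [NormedAddCommGroup F] [NormedSpace ℝ F]
    [CompleteSpace F] {U : Set E} (hU : IsOpen U) [SimplyConnectedSpace U]
    {ω : E → E →L[ℝ] F} (hω : DifferentiableOn ℝ ω U)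
    (hsymm : ∀ x ∈ U, ∀ u v, fderiv ℝ ω x u v = fderiv ℝ ω x v u) :
    ∃ f : E → F, ∀ x ∈ U, HasFDerivAt f (ω x) x := by
  classical
  have : LocallyPathConnectedSpace U := hU.locallyPathConnectedSpace
  have hball : ∀ u : U, ∃ r > 0, Metric.ball (u : E) r ⊆ U := fun u =>
    Metric.isOpen_iff.1 hU u u.2
  choose r hr hrU using hball
  have hprim : ∀ u : U, ∃ f : E → F, ∀ x ∈ Metric.ball (u : E) (r u), HasFDerivAt f (ω x) x :=
    fun u => (convex_ball _ _).exists_forall_hasFDerivAt_of_fderiv_symmetric Metric.isOpen_ball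
      (hω.mono (hrU u)) fun x hx => hsymm x (hrU u hx)
  choose φ hφ using hprim
  obtain ⟨f, hf⟩ := exists_global_of_locally_const_sub
    (fun u : U => Subtype.val ⁻¹' Metric.ball (u : E) (r u))
    (fun u => Metric.isOpen_ball.preimage continuous_subtype_val)
    (fun u => Metric.mem_ball_self (hr u)) (fun u x => φ u x) <| by
      rintro i j x ⟨hi, hj⟩
      have ho : IsOpen (Metric.ball (i : E) (r i) ∩ Metric.ball (j : E) (r j)) :=
        Metric.isOpen_ball.inter Metric.isOpen_ball
      have hd : ∀ y ∈ Metric.ball (i : E) (r i) ∩ Metric.ball (j : E) (r j),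
          HasFDerivAt (fun y => φ i y - φ j y) (0 : E →L[ℝ] F) y := fun y hy => by
        simpa using (hφ i y hy.1).fun_sub (hφ j y hy.2)
      filter_upwards [(ho.preimage continuous_subtype_val).mem_nhds ⟨hi, hj⟩] with y hy
      exact ho.is_const_of_fderiv_eq_zero
        ((convex_ball _ _).inter (convex_ball _ _)).isPreconnected
        (fun z hz => (hd z hz).differentiableAt.differentiableWithinAt)
        (fun z hz => (hd z hz).fderiv) hy ⟨hi, hj⟩
  refine ⟨fun x => if hx : x ∈ U then f ⟨x, hx⟩ else 0, fun x hx => ?_⟩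
  have h := hf ⟨x, hx⟩
  rw [nhds_subtype_eq_comap, eventually_comap] at h
  refine ((hφ ⟨x, hx⟩ x (Metric.mem_ball_self (hr _))).add_const
    (f ⟨x, hx⟩ - φ ⟨x, hx⟩ x)).congr_of_eventuallyEq ?_
  filter_upwards [h, hU.mem_nhds hx] with y hy hyU
  rw [dif_pos hyU, ← hy ⟨y, hyU⟩ rfl]
  abel

/-- The partial derivative of `f` in the `i`-th coordinate direction. -/
noncomputable def pderivAt {n : ℕ} (i : Fin n) (f : (Fin n → ℝ) → ℝ) : (Fin n → ℝ) → ℝ :=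
  fun p => fderiv ℝ f p (Pi.single i 1)

section pderivAt

variable {n : ℕ} {U : Set (Fin n → ℝ)} {f g : (Fin n → ℝ) → ℝ} {p : Fin n → ℝ}

theorem pderivAt_add (i : Fin n) (hf : DifferentiableAt ℝ f p) (hg : DifferentiableAt ℝ g p) :
    pderivAt i (fun q => f q + g q) p = pderivAt i f p + pderivAt i g p := by
  simp [pderivAt, fderiv_fun_add hf hg]

theorem pderivAt_sub (i : Fin n) (hf : DifferentiableAt ℝ f p) (hg : DifferentiableAt ℝ g p) :
    pderivAt i (fun q => f q - g q) p = pderivAt i f p - pderivAt i g p := by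
  simp [pderivAt, fderiv_fun_sub hf hg]

theorem pderivAt_mul (i : Fin n) (hf : DifferentiableAt ℝ f p) (hg : DifferentiableAt ℝ g p) :
    pderivAt i (fun q => f q * g q) p = pderivAt i f p * g p + f p * pderivAt i g p := by
  simp [pderivAt, fderiv_fun_mul hf hg]
  ring

theorem pderivAt_pow (i : Fin n) (k : ℕ) (hf : DifferentiableAt ℝ f p) :
    pderivAt i (fun q => f q ^ k) p = k * f p ^ (k - 1) * pderivAt i f p := by
  simp [pderivAt, fderiv_fun_pow k hf]

theorem pderivAt_const (i : Fin n) (c : ℝ) : pderivAt i (fun _ => c) p = 0 := by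
  simp [pderivAt]

theorem pderivAt_coord (i j : Fin n) :
    pderivAt i (fun q => q j) p = if j = i then 1 else 0 := by
  have : HasFDerivAt (fun q : Fin n → ℝ => q j) (ContinuousLinearMap.proj (R := ℝ) j) p :=
    hasFDerivAt_apply j p
  simp [pderivAt, this.fderiv, Pi.single_apply]

theorem pderivAt_congr (hU : IsOpen U) (h : EqOn f g U) (i : Fin n) :
    EqOn (pderivAt i f) (pderivAt i g) U := fun p hp => by
  simp only [pderivAt, (h.eventuallyEq_of_mem (hU.mem_nhds hp)).fderiv_eq]

theorem contDiffOn_pderivAt (hU : IsOpen U) (hf : ContDiffOn ℝ (⊤ : ℕ∞) f U) (i : Fin n) :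
    ContDiffOn ℝ (⊤ : ℕ∞) (pderivAt i f) U :=
  (hf.fderiv_of_isOpen hU (m := (⊤ : ℕ∞)) (by simp)).clm_apply contDiffOn_const

theorem ContDiffOn.differentiableAt_of_isOpen (hU : IsOpen U) (hf : ContDiffOn ℝ (⊤ : ℕ∞) f U)
    (hp : p ∈ U) : DifferentiableAt ℝ f p :=
  (hf.contDiffAt (hU.mem_nhds hp)).differentiableAt (by simp)

theorem pderivAt_comm (hU : IsOpen U) (hf : ContDiffOn ℝ (⊤ : ℕ∞) f U) (i j : Fin n) :
    EqOn (pderivAt i (pderivAt j f)) (pderivAt j (pderivAt i f)) U := fun p hp => by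
  have hd : DifferentiableAt ℝ (fderiv ℝ f) p :=
    ((hf.fderiv_of_isOpen hU (m := (⊤ : ℕ∞)) (by simp)).contDiffAt
      (hU.mem_nhds hp)).differentiableAt (by simp)
  have key : ∀ k l : Fin n, pderivAt k (pderivAt l f) p
      = fderiv ℝ (fderiv ℝ f) p (Pi.single k 1) (Pi.single l 1) := fun k l => by
    change fderiv ℝ (fun q => fderiv ℝ f q (Pi.single l 1)) p (Pi.single k 1) = _
    rw [fderiv_clm_apply hd (differentiableAt_const _)]
    simp
  rw [key, key]
  refine ((hf.contDiffAt (hU.mem_nhds hp)).isSymmSndFDerivAt ?_).eq _ _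
  rw [minSmoothness_of_isRCLikeNormedField]
  exact WithTop.coe_le_coe.2 le_top

theorem fderiv_apply_eq_sum_pderivAt (v : Fin n → ℝ) :
    fderiv ℝ f p v = ∑ i, v i * pderivAt i f p := by
  conv_lhs => rw [pi_eq_sum_univ' v, map_sum]
  simp only [map_smul, smul_eq_mul, pderivAt]

/-- The Poincaré lemma for `1`-forms in coordinates, on simply connected open sets. -/
theorem exists_pderivAt_eq_of_closed (hU : IsOpen U) [SimplyConnectedSpace U]
    {w : Fin n → (Fin n → ℝ) → ℝ} (hw : ∀ j, ContDiffOn ℝ (⊤ : ℕ∞) (w j) U)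
    (hclosed : ∀ i j, ∀ p ∈ U, pderivAt i (w j) p = pderivAt j (w i) p) :
    ∃ f, ContDiffOn ℝ (⊤ : ℕ∞) f U ∧ ∀ i, EqOn (pderivAt i f) (w i) U := by
  let ω : (Fin n → ℝ) → (Fin n → ℝ) →L[ℝ] ℝ :=
    fun p => ∑ j, w j p • ContinuousLinearMap.proj (R := ℝ) j
  have hω : ContDiffOn ℝ (⊤ : ℕ∞) ω U :=
    ContDiffOn.sum fun j _ => (hw j).smul contDiffOn_const
  have hωapp : ∀ p v, ω p v = ∑ j, w j p * v j := fun p v => by simp [ω]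
  have hωd : DifferentiableOn ℝ ω U := hω.differentiableOn (by simp)
  have hderiv : ∀ p ∈ U, ∀ u v, fderiv ℝ ω p u v
      = ∑ j, ∑ i, u i * pderivAt i (w j) p * v j := fun p hp u v => by
    have h1 : fderiv ℝ (fun q => ω q v) p u = fderiv ℝ ω p u v := by
      rw [fderiv_clm_apply (hωd.differentiableAt (hU.mem_nhds hp)) (differentiableAt_const _)]
      simp
    have hd : ∀ j, DifferentiableAt ℝ (w j) p := fun j => (hw j).differentiableAt_of_isOpen hU hp
    rw [← h1]
    simp only [hωapp]
    rw [fderiv_fun_sum fun j _ => (hd j).mul_const _, sum_apply]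
    refine Finset.sum_congr rfl fun j _ => ?_
    rw [fderiv_mul_const (hd j), smul_apply, fderiv_apply_eq_sum_pderivAt,
      smul_eq_mul, mul_comm, Finset.sum_mul]
  obtain ⟨f, hf⟩ := exists_forall_hasFDerivAt_of_simplyConnected hU hωd fun p hp u v => by
    rw [hderiv p hp, hderiv p hp, Finset.sum_comm]
    refine Finset.sum_congr rfl fun i _ => Finset.sum_congr rfl fun j _ => ?_
    rw [hclosed i j p hp]
    ring
  refine ⟨f, ?_, fun i p hp => ?_⟩
  · rw [contDiffOn_infty_iff_fderiv_of_isOpen hU]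
    exact ⟨fun p hp => (hf p hp).differentiableAt.differentiableWithinAt,
      hω.congr fun p hp => (hf p hp).fderiv⟩
  · simp [pderivAt, (hf p hp).fderiv, hωapp, Pi.single_apply]

end pderivAt

theorem opX_eq (f : (Fin 3 → ℝ) → ℝ) : opX f = pderivAt 0 f := by
  ext p
  simp [opX, fderiv_apply_eq_sum_pderivAt, Fin.sum_univ_three]

theorem opY_eq (f : (Fin 3 → ℝ) → ℝ) :
    opY f = fun p => p 0 ^ 2 * pderivAt 1 f p + pderivAt 2 f p := by
  ext p
  simp [opY, fderiv_apply_eq_sum_pderivAt, Fin.sum_univ_three]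

theorem opZ_eq (f : (Fin 3 → ℝ) → ℝ) : opZ f = fun p => 2 * p 0 * pderivAt 1 f p := by
  ext p
  simp [opZ, fderiv_apply_eq_sum_pderivAt, Fin.sum_univ_three]

theorem opW_eq (f : (Fin 3 → ℝ) → ℝ) : opW f = fun p => 2 * pderivAt 1 f p := by
  ext p
  simp [opW, fderiv_apply_eq_sum_pderivAt, Fin.sum_univ_three]

section Martinet

variable {U : Set (Fin 3 → ℝ)} {a b : (Fin 3 → ℝ) → ℝ}

theorem martinet_system_iff (hU : IsOpen U) (ha : ContDiffOn ℝ (⊤ : ℕ∞) a U)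
    {p : Fin 3 → ℝ} (hp : p ∈ U) :
    (opX (opX (opX b)) p = opX (opX (opY a)) p + opX (opZ a) p + opW a p ∧
      opY (opY a) p = opY (opX b) p - opZ b p) ↔
    (pderivAt 0 (pderivAt 0 (pderivAt 0 b)) p
        = p 0 ^ 2 * pderivAt 0 (pderivAt 0 (pderivAt 1 a)) p
          + pderivAt 0 (pderivAt 0 (pderivAt 2 a)) p
          + 6 * p 0 * pderivAt 0 (pderivAt 1 a) p + 6 * pderivAt 1 a p ∧
      p 0 ^ 2 * (p 0 ^ 2 * pderivAt 1 (pderivAt 1 a) p + pderivAt 1 (pderivAt 2 a) p)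
          + (p 0 ^ 2 * pderivAt 2 (pderivAt 1 a) p + pderivAt 2 (pderivAt 2 a) p)
        = p 0 ^ 2 * pderivAt 1 (pderivAt 0 b) p + pderivAt 2 (pderivAt 0 b) p
          - 2 * p 0 * pderivAt 1 b p) := by
  have s (i : Fin 3) := contDiffOn_pderivAt hU ha i
  have d (i : Fin 3) {q} (hq : q ∈ U) := (s i).differentiableAt_of_isOpen hU hq
  have d' (i j : Fin 3) {q} (hq : q ∈ U) :=
    (contDiffOn_pderivAt hU (s i) j).differentiableAt_of_isOpen hU hq
  have hY (i : Fin 3) : EqOn (pderivAt i fun q => q 0 ^ 2 * pderivAt 1 a q + pderivAt 2 a q)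
      (fun q => 2 * q 0 * (if (0 : Fin 3) = i then 1 else 0) * pderivAt 1 a q
        + q 0 ^ 2 * pderivAt i (pderivAt 1 a) q + pderivAt i (pderivAt 2 a) q) U := fun q hq => by
    have d1 := d 1 hq
    have d2 := d 2 hq
    simp (disch := fun_prop) only [pderivAt_add, pderivAt_mul, pderivAt_pow, pderivAt_coord]
    simp
  have d1 := d 1 hp
  have d2 := d 2 hp
  have d10 := d' 1 0 hp
  have d20 := d' 2 0 hp
  have hXXY := pderivAt_congr hU (hY 0) 0 hp
  have hXZ : pderivAt 0 (fun q => 2 * q 0 * pderivAt 1 a q) p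
      = 2 * pderivAt 1 a p + 2 * p 0 * pderivAt 0 (pderivAt 1 a) p := by
    simp (disch := fun_prop) only [pderivAt_mul, pderivAt_const, pderivAt_coord]
    simp
  simp (disch := fun_prop) only [pderivAt_add, pderivAt_mul, pderivAt_pow, pderivAt_coord,
    pderivAt_const] at hXXY
  simp only [opX_eq, opY_eq, opZ_eq, opW_eq, hXXY, hXZ, hY 1 hp, hY 2 hp]
  norm_num [show (0 : Fin 3) ≠ 2 by decide]
  refine fun _ => ⟨fun h => ?_, fun h => ?_⟩ <;> linear_combination h

/-- The obstruction `Xb - Ya - x Wf`, with `P` in the role of `Wf / 2`, has vanishing gradient. -/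
theorem pderivAt_martinet_obstruction_eq_zero (hU : IsOpen U)
    (ha : ContDiffOn ℝ (⊤ : ℕ∞) a U) (hb : ContDiffOn ℝ (⊤ : ℕ∞) b U)
    {P : (Fin 3 → ℝ) → ℝ} (hP : ContDiffOn ℝ (⊤ : ℕ∞) P U)
    (hP0 : EqOn (pderivAt 0 P) (pderivAt 1 a) U)
    (hbP : ∀ p ∈ U, pderivAt 0 (pderivAt 0 b) p = 2 * P p + 4 * p 0 * pderivAt 1 a p
      + p 0 ^ 2 * pderivAt 0 (pderivAt 1 a) p + pderivAt 0 (pderivAt 2 a) p)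
    (hYY : ∀ p ∈ U,
      p 0 ^ 2 * (p 0 ^ 2 * pderivAt 1 (pderivAt 1 a) p + pderivAt 1 (pderivAt 2 a) p)
          + (p 0 ^ 2 * pderivAt 2 (pderivAt 1 a) p + pderivAt 2 (pderivAt 2 a) p)
        = p 0 ^ 2 * pderivAt 1 (pderivAt 0 b) p + pderivAt 2 (pderivAt 0 b) p
          - 2 * p 0 * pderivAt 1 b p) {p : Fin 3 → ℝ} (hp : p ∈ U) :
    (∀ i, pderivAt i (fun q => pderivAt 0 b q
      - (q 0 ^ 2 * pderivAt 1 a q + pderivAt 2 a q) - 2 * q 0 * P q) p = 0) ∧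
    pderivAt 1 b p = p 0 ^ 2 * pderivAt 1 P p + pderivAt 2 P p := by
  have sa (i : Fin 3) := contDiffOn_pderivAt hU ha i
  have sb (i : Fin 3) := contDiffOn_pderivAt hU hb i
  have sP (i : Fin 3) := contDiffOn_pderivAt hU hP i
  have hcoord : ContDiffOn ℝ (⊤ : ℕ∞) (fun q : Fin 3 → ℝ => q 0) U :=
    (contDiff_apply ℝ ℝ (0 : Fin 3)).contDiffOn
  set h : (Fin 3 → ℝ) → ℝ := fun q => pderivAt 0 b q
    - (q 0 ^ 2 * pderivAt 1 a q + pderivAt 2 a q) - 2 * q 0 * P q with h_def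
  have sh : ContDiffOn ℝ (⊤ : ℕ∞) h U :=
    ((sb 0).sub (((hcoord.pow 2).mul (sa 1)).add (sa 2))).sub
      ((contDiffOn_const.mul hcoord).mul hP)
  have hh (i : Fin 3) {q} (hq : q ∈ U) : pderivAt i h q = pderivAt i (pderivAt 0 b) q
      - (2 * q 0 * (if (0 : Fin 3) = i then 1 else 0) * pderivAt 1 a q
        + q 0 ^ 2 * pderivAt i (pderivAt 1 a) q + pderivAt i (pderivAt 2 a) q)
      - (2 * (if (0 : Fin 3) = i then 1 else 0) * P q + 2 * q 0 * pderivAt i P q) := by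
    have d1 := (sa 1).differentiableAt_of_isOpen hU hq
    have d2 := (sa 2).differentiableAt_of_isOpen hU hq
    have d3 := (sb 0).differentiableAt_of_isOpen hU hq
    have d4 := hP.differentiableAt_of_isOpen hU hq
    simp (disch := fun_prop) only [h_def, pderivAt_add, pderivAt_sub, pderivAt_mul, pderivAt_pow,
      pderivAt_coord, pderivAt_const]
    norm_num
  have h0 : EqOn (pderivAt 0 h) (fun _ => 0) U := fun q hq => by
    rw [hh 0 hq, hP0 hq, hbP q hq, if_pos rfl]
    ring
  have hne : (0 : Fin 3) ≠ 1 ∧ (0 : Fin 3) ≠ 2 := by decide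
  have h1 {q} (hq : q ∈ U) := hh 1 hq
  have h2 {q} (hq : q ∈ U) := hh 2 hq
  simp only [hne.1, hne.2, if_false] at h1 h2
  have hYh : EqOn (fun q => q 0 ^ 2 * pderivAt 1 h q + pderivAt 2 h q)
      (fun q => 2 * q 0 * (pderivAt 1 b q - (q 0 ^ 2 * pderivAt 1 P q + pderivAt 2 P q))) U :=
    fun q hq => by
      simp only [h1 hq, h2 hq]
      linear_combination -hYY q hq
  have hcomm (i : Fin 3) {q} (hq : q ∈ U) : pderivAt 0 (pderivAt i h) q = 0 := by
    rw [pderivAt_comm hU sh 0 i hq, pderivAt_congr hU h0 i hq, pderivAt_const]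
  have hXYh {q} (hq : q ∈ U) :
      pderivAt 0 (fun q => q 0 ^ 2 * pderivAt 1 h q + pderivAt 2 h q) q
        = 2 * q 0 * pderivAt 1 h q := by
    have d1 := (contDiffOn_pderivAt hU sh 1).differentiableAt_of_isOpen hU hq
    have d2 := (contDiffOn_pderivAt hU sh 2).differentiableAt_of_isOpen hU hq
    simp (disch := fun_prop) only [pderivAt_add, pderivAt_mul, pderivAt_pow, pderivAt_coord,
      hcomm _ hq]
    norm_num
  have hbY {q} (hq : q ∈ U) : pderivAt 1 b q = q 0 ^ 2 * pderivAt 1 P q + pderivAt 2 P q := by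
    have key := pderivAt_congr hU hYh 0 hq
    have d1 := (sb 1).differentiableAt_of_isOpen hU hq
    have d2 := (sP 1).differentiableAt_of_isOpen hU hq
    have d3 := (sP 2).differentiableAt_of_isOpen hU hq
    rw [hXYh hq, h1 hq] at key
    simp (disch := fun_prop) only [pderivAt_add, pderivAt_sub, pderivAt_mul, pderivAt_pow,
      pderivAt_coord, pderivAt_const, pderivAt_comm hU hP 0 _ hq, pderivAt_congr hU hP0 _ hq,
      pderivAt_comm hU hb 0 1 hq, pderivAt_comm hU ha 2 1 hq] at key
    norm_num at key
    linear_combination -key / 2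
  have hYh' : EqOn (fun q => q 0 ^ 2 * pderivAt 1 h q + pderivAt 2 h q) (fun _ => 0) U :=
    fun q hq => by rw [hYh hq]; simp only [hbY hq]; ring
  have hZh : EqOn (fun q => 2 * q 0 * pderivAt 1 h q) (fun _ => 0) U := fun q hq => by
    simp only [← hXYh hq, pderivAt_congr hU hYh' 0 hq, pderivAt_const]
  have hh1 : pderivAt 1 h p = 0 := by
    have key := pderivAt_congr hU hZh 0 hp
    have d1 := (contDiffOn_pderivAt hU sh 1).differentiableAt_of_isOpen hU hp
    simp (disch := fun_prop) only [pderivAt_mul, pderivAt_coord, pderivAt_const, hcomm _ hp] at key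
    norm_num at key
    exact key
  refine ⟨fun i => ?_, hbY hp⟩
  fin_cases i
  · exact h0 hp
  · exact hh1
  · simpa [hh1] using hYh' hp

theorem exists_martinet_potential (hU : IsOpen U) [SimplyConnectedSpace U]
    (ha : ContDiffOn ℝ (⊤ : ℕ∞) a U) (hb : ContDiffOn ℝ (⊤ : ℕ∞) b U)
    (h : ∀ p ∈ U, opX (opX (opX b)) p = opX (opX (opY a)) p + opX (opZ a) p + opW a p ∧
      opY (opY a) p = opY (opX b) p - opZ b p) :
    ∃ f : (Fin 3 → ℝ) → ℝ, ∃ C : ℝ, ContDiffOn ℝ (⊤ : ℕ∞) f U ∧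
      ∀ p ∈ U, opX f p = a p ∧ opY f p = C * p 0 + b p := by
  have hE {p} (hp : p ∈ U) := (martinet_system_iff hU ha hp).1 (h p hp)
  have sa (i : Fin 3) := contDiffOn_pderivAt hU ha i
  have sb (i : Fin 3) := contDiffOn_pderivAt hU hb i
  have hcoord : ContDiffOn ℝ (⊤ : ℕ∞) (fun q : Fin 3 → ℝ => q 0) U :=
    (contDiff_apply ℝ ℝ (0 : Fin 3)).contDiffOn
  let P : (Fin 3 → ℝ) → ℝ := fun q => 2⁻¹ * (pderivAt 0 (pderivAt 0 b) q
    - (4 * q 0 * pderivAt 1 a q + q 0 ^ 2 * pderivAt 0 (pderivAt 1 a) q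
      + pderivAt 0 (pderivAt 2 a) q))
  have hP : ContDiffOn ℝ (⊤ : ℕ∞) P U :=
    contDiffOn_const.mul ((contDiffOn_pderivAt hU (sb 0) 0).sub
      ((((contDiffOn_const.mul hcoord).mul (sa 1)).add
        ((hcoord.pow 2).mul (contDiffOn_pderivAt hU (sa 1) 0))).add
          (contDiffOn_pderivAt hU (sa 2) 0)))
  have hP0 : EqOn (pderivAt 0 P) (pderivAt 1 a) U := fun q hq => by
    have d1 := (sa 1).differentiableAt_of_isOpen hU hq
    have d2 := (contDiffOn_pderivAt hU (sb 0) 0).differentiableAt_of_isOpen hU hq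
    have d3 := (contDiffOn_pderivAt hU (sa 1) 0).differentiableAt_of_isOpen hU hq
    have d4 := (contDiffOn_pderivAt hU (sa 2) 0).differentiableAt_of_isOpen hU hq
    simp (disch := fun_prop) only [P, pderivAt_add, pderivAt_sub, pderivAt_mul, pderivAt_pow,
      pderivAt_coord, pderivAt_const, (hE hq).1]
    norm_num
    ring
  have hobs {p} (hp : p ∈ U) := pderivAt_martinet_obstruction_eq_zero hU ha hb hP hP0
    (fun p _ => by simp only [P]; ring) (fun p hp => (hE hp).2) hp
  have hpre : IsPreconnected U := isPreconnected_iff_preconnectedSpace.2 inferInstance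
  set g : (Fin 3 → ℝ) → ℝ := fun q => pderivAt 0 b q
    - (q 0 ^ 2 * pderivAt 1 a q + pderivAt 2 a q) - 2 * q 0 * P q with g_def
  have sg : ContDiffOn ℝ (⊤ : ℕ∞) g U :=
    ((sb 0).sub (((hcoord.pow 2).mul (sa 1)).add (sa 2))).sub
      ((contDiffOn_const.mul hcoord).mul hP)
  obtain ⟨C, hC⟩ := hU.exists_is_const_of_fderiv_eq_zero (𝕜 := ℝ) hpre
    (sg.differentiableOn (by simp)) fun p hp => by
      ext v
      simp [fderiv_apply_eq_sum_pderivAt, (hobs hp).1]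
  let w : Fin 3 → (Fin 3 → ℝ) → ℝ := ![a, P, fun q => -C * q 0 + b q - q 0 ^ 2 * P q]
  have hw2 (i : Fin 3) {q} (hq : q ∈ U) : pderivAt i (w 2) q
      = -C * (if (0 : Fin 3) = i then 1 else 0) + pderivAt i b q
        - (2 * q 0 * (if (0 : Fin 3) = i then 1 else 0) * P q + q 0 ^ 2 * pderivAt i P q) := by
    have d1 := hb.differentiableAt_of_isOpen hU hq
    have d2 := hP.differentiableAt_of_isOpen hU hq
    change pderivAt i (fun q => -C * q 0 + b q - q 0 ^ 2 * P q) q = _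
    simp (disch := fun_prop) only [pderivAt_add, pderivAt_sub, pderivAt_mul, pderivAt_pow,
      pderivAt_coord, pderivAt_const]
    norm_num
  have hne : (0 : Fin 3) ≠ 1 := by decide
  have h01 {q} (hq : q ∈ U) : pderivAt 0 (w 1) q = pderivAt 1 (w 0) q := hP0 hq
  have h02 {q} (hq : q ∈ U) : pderivAt 0 (w 2) q = pderivAt 2 (w 0) q := by
    have := hC q hq
    rw [hw2 0 hq, hP0 hq, if_pos rfl]
    change _ = pderivAt 2 a q
    simp only [g_def] at this
    linear_combination this
  have h12 {q} (hq : q ∈ U) : pderivAt 1 (w 2) q = pderivAt 2 (w 1) q := by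
    rw [hw2 1 hq, if_neg hne, (hobs hq).2]
    change _ = pderivAt 2 P q
    ring
  obtain ⟨f, hf, hfw⟩ := exists_pderivAt_eq_of_closed hU (w := w)
    (fun j => by
      fin_cases j
      · exact ha
      · exact hP
      · exact ((contDiffOn_const.mul hcoord).add hb).sub ((hcoord.pow 2).mul hP))
    (fun i j p hp => by
      fin_cases i <;> fin_cases j
      exacts [rfl, h01 hp, h02 hp, (h01 hp).symm, rfl, h12 hp, (h02 hp).symm, (h12 hp).symm, rfl])
  refine ⟨f, -C, hf, fun p hp => ?_⟩
  simp only [opX_eq, opY_eq, hfw _ hp]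
  refine ⟨rfl, ?_⟩
  change p 0 ^ 2 * P p + (-C * p 0 + b p - p 0 ^ 2 * P p) = _
  ring

theorem martinet_system_of_potential (hU : IsOpen U) (ha : ContDiffOn ℝ (⊤ : ℕ∞) a U)
    {f : (Fin 3 → ℝ) → ℝ} {C : ℝ} (hf : ContDiffOn ℝ (⊤ : ℕ∞) f U)
    (h : ∀ p ∈ U, opX f p = a p ∧ opY f p = C * p 0 + b p) {p : Fin 3 → ℝ} (hp : p ∈ U) :
    opX (opX (opX b)) p = opX (opX (opY a)) p + opX (opZ a) p + opW a p ∧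
      opY (opY a) p = opY (opX b) p - opZ b p := by
  have sf (i : Fin 3) := contDiffOn_pderivAt hU hf i
  have sa (i : Fin 3) := contDiffOn_pderivAt hU ha i
  have hfa : EqOn (pderivAt 0 f) a U := fun q hq => by rw [← opX_eq, (h q hq).1]
  have hfb : EqOn b (fun q => q 0 ^ 2 * pderivAt 1 f q + pderivAt 2 f q - C * q 0) U :=
    fun q hq => by
      have := (h q hq).2
      rw [opY_eq] at this
      simp only [this]
      ring
  have hcomm (i : Fin 3) : EqOn (pderivAt 0 (pderivAt i f)) (pderivAt i a) U := fun q hq => by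
    rw [pderivAt_comm hU hf 0 i hq, pderivAt_congr hU hfa i hq]
  have hb0 : EqOn (pderivAt 0 b) (fun q => 2 * q 0 * pderivAt 1 f q
      + q 0 ^ 2 * pderivAt 1 a q + pderivAt 2 a q - C) U := fun q hq => by
    have d1 := (sf 1).differentiableAt_of_isOpen hU hq
    have d2 := (sf 2).differentiableAt_of_isOpen hU hq
    rw [pderivAt_congr hU hfb 0 hq]
    simp (disch := fun_prop) only [pderivAt_add, pderivAt_sub, pderivAt_mul, pderivAt_pow,
      pderivAt_coord, pderivAt_const, hcomm _ hq]
    norm_num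
  have hb00 : EqOn (pderivAt 0 (pderivAt 0 b)) (fun q => 2 * pderivAt 1 f q
      + 4 * q 0 * pderivAt 1 a q + q 0 ^ 2 * pderivAt 0 (pderivAt 1 a) q
      + pderivAt 0 (pderivAt 2 a) q) U := fun q hq => by
    have d1 := (sf 1).differentiableAt_of_isOpen hU hq
    have d2 := (sa 1).differentiableAt_of_isOpen hU hq
    have d3 := (sa 2).differentiableAt_of_isOpen hU hq
    rw [pderivAt_congr hU hb0 0 hq]
    simp (disch := fun_prop) only [pderivAt_add, pderivAt_sub, pderivAt_mul, pderivAt_pow,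
      pderivAt_coord, pderivAt_const, hcomm _ hq]
    norm_num
    ring
  have d1 := (sf 1).differentiableAt_of_isOpen hU hp
  have d2 := (sf 2).differentiableAt_of_isOpen hU hp
  have d3 := (sa 1).differentiableAt_of_isOpen hU hp
  have d4 := (sa 2).differentiableAt_of_isOpen hU hp
  have d5 := (contDiffOn_pderivAt hU (sa 1) 0).differentiableAt_of_isOpen hU hp
  have d6 := (contDiffOn_pderivAt hU (sa 2) 0).differentiableAt_of_isOpen hU hp
  have hne : (0 : Fin 3) ≠ 1 ∧ (0 : Fin 3) ≠ 2 := by decide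
  refine (martinet_system_iff hU ha hp).2 ⟨?_, ?_⟩
  · rw [pderivAt_congr hU hb00 0 hp]
    simp (disch := fun_prop) only [pderivAt_add, pderivAt_mul, pderivAt_pow,
      pderivAt_coord, pderivAt_const, hcomm _ hp]
    norm_num
    ring
  · rw [pderivAt_congr hU hb0 1 hp, pderivAt_congr hU hb0 2 hp, pderivAt_congr hU hfb 1 hp]
    simp (disch := fun_prop) only [pderivAt_add, pderivAt_sub, pderivAt_mul, pderivAt_pow,
      pderivAt_coord, pderivAt_const, hne.1, hne.2, if_false, pderivAt_comm hU hf 2 1 hp]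
    ring

end Martinet

theorem martinet_integrability
    (U : Set (Fin 3 → ℝ)) (hU : IsOpen U) (hUc : ContractibleSpace U)
    (a b : (Fin 3 → ℝ) → ℝ)
    (ha : ContDiffOn ℝ (⊤ : ℕ∞) a U) (hb : ContDiffOn ℝ (⊤ : ℕ∞) b U) :
    (∀ p ∈ U, opX (opX (opX b)) p =
                opX (opX (opY a)) p + opX (opZ a) p + opW a p ∧
              opY (opY a) p = opY (opX b) p - opZ b p) ↔
    (∃ f : (Fin 3 → ℝ) → ℝ, ∃ C : ℝ, ContDiffOn ℝ (⊤ : ℕ∞) f U ∧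
      ∀ p ∈ U, opX f p = a p ∧ opY f p = C * p 0 + b p) := by
  have : SimplyConnectedSpace U := SimplyConnectedSpace.ofContractible U
  exact ⟨exists_martinet_potential hU ha hb,
    fun ⟨_, _, hf, h⟩ _ hp => martinet_system_of_potential hU ha hf h hp⟩
end

section
/- Let U ⊆ ℝ³ be a contractible open set. Then the Martinet complex is exact at its final term: for every smooth function ρ : U → ℝ there exist smooth functions g, h : U → ℝ such that Xh − Yg = ρ on U. -/
open MeasureTheory Set Filter Topology
open scoped ContDiff Manifold

/-- The vector field `V` on `ℝ³` is smooth near `x` and has divergence `d` at `x`. -/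
def HasSmoothDivAt (V : (Fin 3 → ℝ) → Fin 3 → ℝ) (d : ℝ) (x : Fin 3 → ℝ) : Prop :=
  ContDiffAt ℝ ∞ V x ∧ ∑ i, fderiv ℝ V x (Pi.single i 1) i = d

namespace HasSmoothDivAt

variable {V W : (Fin 3 → ℝ) → Fin 3 → ℝ} {d e : ℝ} {x : Fin 3 → ℝ}

lemma congr_of_eventuallyEq (h : HasSmoothDivAt V d x) (hW : W =ᶠ[𝓝 x] V) :
    HasSmoothDivAt W d x :=
  ⟨h.1.congr_of_eventuallyEq hW, by rw [hW.fderiv_eq, h.2]⟩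

lemma zero : HasSmoothDivAt (fun _ => 0) 0 x :=
  ⟨contDiffAt_const, by simp⟩

lemma add (hV : HasSmoothDivAt V d x) (hW : HasSmoothDivAt W e x) :
    HasSmoothDivAt (fun y => V y + W y) (d + e) x := by
  refine ⟨hV.1.add hW.1, ?_⟩
  rw [fderiv_fun_add (hV.1.differentiableAt (by simp)) (hW.1.differentiableAt (by simp)),
    ← hV.2, ← hW.2, ← Finset.sum_add_distrib]
  rfl

lemma sum {ι : Type*} {V : ι → (Fin 3 → ℝ) → Fin 3 → ℝ} {d : ι → ℝ} {s : Finset ι}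
    (h : ∀ i ∈ s, HasSmoothDivAt (V i) (d i) x) :
    HasSmoothDivAt (fun y => ∑ i ∈ s, V i y) (∑ i ∈ s, d i) x := by
  classical
  induction s using Finset.induction_on with
  | empty => simpa using zero
  | insert a s ha ih =>
    simp only [Finset.sum_insert ha]
    exact (h a (by simp)).add (ih fun i hi => h i (by simp [hi]))

end HasSmoothDivAt

/-- The density `t² (1_(0,1] - a 1_(0,∞))`. -/
noncomputable def radialWeight (a t : ℝ) : ℝ :=
  (Ioc 0 1).indicator (· ^ 2) t - a * (Ioi 0).indicator (· ^ 2) t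

/-- The average of `ρ` along the line through `q` and `x`, weighted by `radialWeight a`. -/
noncomputable def radialMean (a : ℝ) (q : Fin 3 → ℝ) (ρ : (Fin 3 → ℝ) → ℝ)
    (x : Fin 3 → ℝ) : ℝ :=
  ∫ t, radialWeight a t * ρ (q + t • (x - q))

section Radial

variable {ρ : (Fin 3 → ℝ) → ℝ} {q x : Fin 3 → ℝ} (a : ℝ)

lemma locallyIntegrable_radialWeight : LocallyIntegrable (radialWeight a) := by
  have hsq : LocallyIntegrable (fun t : ℝ => t ^ 2) :=
    (continuous_pow 2).locallyIntegrable
  exact (hsq.indicator measurableSet_Ioc).sub ((hsq.indicator measurableSet_Ioi).smul a)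

lemma contDiffAt_radialMean (hρ : ContDiff ℝ ∞ ρ) (hc : HasCompactSupport ρ) (hx : x ≠ q) :
    ContDiffAt ℝ ∞ (radialMean a q ρ) x := by
  obtain ⟨R, hR⟩ : ∃ R, ∀ y, ρ y ≠ 0 → ‖y - q‖ ≤ R := by
    obtain ⟨R, hR⟩ := hc.isCompact.isBounded.subset_closedBall q
    exact ⟨R, fun y hy => by simpa [dist_eq_norm] using hR (subset_tsupport _ hy)⟩
  have hδ : 0 < ‖x - q‖ / 2 := by
    have := norm_pos_iff.2 (sub_ne_zero.2 hx)
    positivity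
  set δ := ‖x - q‖ / 2 with hδ_def
  have hs : IsOpen {y : Fin 3 → ℝ | δ < ‖y - q‖} :=
    isOpen_lt continuous_const (by fun_prop)
  have key := contDiffOn_convolution_right_with_param_comp (μ := volume) (n := (⊤ : ℕ∞))
    (ContinuousLinearMap.mul ℝ ℝ) (v := fun _ : Fin 3 → ℝ => (0 : ℝ)) contDiffOn_const
    (f := radialWeight a) (g := fun y t => ρ (q - t • (y - q))) hs
    (isCompact_closedBall (0 : ℝ) (R / δ)) ?_ (locallyIntegrable_radialWeight a)
    (ContDiff.contDiffOn (hρ.comp (by fun_prop)))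
  · refine (key.congr fun y _ => ?_).contDiffAt (hs.mem_nhds ?_)
    · simp [radialMean, convolution]
    · change δ < ‖x - q‖
      linarith
  · intro y t hy ht
    by_contra hne
    have h1 := hR _ hne
    rw [sub_sub_cancel_left, norm_neg, norm_smul] at h1
    refine ht (mem_closedBall_zero_iff.2 ?_)
    rw [le_div_iff₀ hδ]
    exact (mul_le_mul_of_nonneg_left (le_of_lt hy) (norm_nonneg t)).trans h1

lemma radialMean_lineMap (hρ : ContDiff ℝ ∞ ρ) (hc : HasCompactSupport ρ) (hx : x ≠ q)
    {s : ℝ} (hs : 0 < s) :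
    radialMean a q ρ (q + s • (x - q)) =
      (s ^ 3)⁻¹ * ((∫ t in (0 : ℝ)..s, t ^ 2 * ρ (q + t • (x - q))) -
        a * ∫ t in Ioi (0 : ℝ), t ^ 2 * ρ (q + t • (x - q))) := by
  set φ : ℝ → ℝ := fun t => t ^ 2 * ρ (q + t • (x - q)) with hφ
  have hφc : Continuous φ := by
    have := hρ.continuous
    fun_prop
  have hφs : HasCompactSupport φ := by
    have hemb : IsClosedEmbedding fun t : ℝ => q + t • (x - q) :=
      (Homeomorph.addLeft q).isClosedEmbedding.comp
        (isClosedEmbedding_smul_left (sub_ne_zero.2 hx))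
    exact (hc.comp_isClosedEmbedding hemb).mul_left
  have hφi : Integrable φ := hφc.integrable_of_hasCompactSupport hφs
  have hint : ∀ t, radialWeight a t * ρ (q + t • (q + s • (x - q) - q)) =
      (s ^ 2)⁻¹ * ((Ioc 0 s).indicator φ (s * t) - a * (Ioi 0).indicator φ (s * t)) := by
    intro t
    have h1 : (s * t ∈ Ioc 0 s) ↔ t ∈ Ioc (0 : ℝ) 1 := by
      simp [mul_pos_iff_of_pos_left hs, mul_le_iff_le_one_right hs]
    have h2 : (s * t ∈ Ioi 0) ↔ t ∈ Ioi (0 : ℝ) := by simp [mul_pos_iff_of_pos_left hs]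
    simp only [radialWeight, indicator_apply, h1, h2, hφ, add_sub_cancel_left, smul_smul,
      mul_comm t s]
    split_ifs <;> field_simp <;> ring
  unfold radialMean
  simp_rw [hint]
  rw [integral_const_mul, Measure.integral_comp_mul_left
    (fun u => (Ioc 0 s).indicator φ u - a * (Ioi 0).indicator φ u), integral_sub
    (hφi.indicator measurableSet_Ioc) ((hφi.indicator measurableSet_Ioi).const_mul a),
    integral_const_mul, integral_indicator measurableSet_Ioc,
    integral_indicator measurableSet_Ioi, intervalIntegral.integral_of_le hs.le,
    abs_of_pos (inv_pos.2 hs), smul_eq_mul, ← mul_assoc]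
  congr 1
  field_simp

lemma fderiv_radialMean (hρ : ContDiff ℝ ∞ ρ) (hc : HasCompactSupport ρ) (hx : x ≠ q) :
    fderiv ℝ (radialMean a q ρ) x (x - q) = ρ x - 3 * radialMean a q ρ x := by
  set φ : ℝ → ℝ := fun t => t ^ 2 * ρ (q + t • (x - q)) with hφ
  have hφc : Continuous φ := by
    have := hρ.continuous
    fun_prop
  set C := a * ∫ t in Ioi (0 : ℝ), φ t with hC
  have hmean : radialMean a q ρ x = (∫ t in (0 : ℝ)..1, φ t) - C := by
    simpa [hφ, hC] using radialMean_lineMap a hρ hc hx one_pos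
  have hG : HasDerivAt (fun s => (∫ t in (0 : ℝ)..s, φ t) - C) (φ 1) 1 :=
    (intervalIntegral.integral_hasDerivAt_right (hφc.intervalIntegrable _ _)
      (hφc.stronglyMeasurableAtFilter _ _) hφc.continuousAt).sub_const C
  have hinv : HasDerivAt (fun s : ℝ => (s ^ 3)⁻¹) (-3) 1 := by
    simpa using (hasDerivAt_pow 3 (1 : ℝ)).fun_inv (by norm_num)
  have hprod := hinv.mul hG
  have hline : HasDerivAt (fun s : ℝ => q + s • (x - q)) (x - q) 1 := by
    simpa using ((hasDerivAt_id (1 : ℝ)).smul_const (x - q)).const_add q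
  have hF : HasFDerivAt (radialMean a q ρ) (fderiv ℝ (radialMean a q ρ) x)
      (q + (1 : ℝ) • (x - q)) := by
    simpa using ((contDiffAt_radialMean a hρ hc hx).differentiableAt (by simp)).hasFDerivAt
  have hcomp := hF.comp_hasDerivAt (1 : ℝ) hline
  have heq : (radialMean a q ρ ∘ fun s : ℝ => q + s • (x - q)) =ᶠ[𝓝 1]
      fun s => (s ^ 3)⁻¹ * ((∫ t in (0 : ℝ)..s, φ t) - C) := by
    filter_upwards [lt_mem_nhds (one_pos : (0 : ℝ) < 1)] with s hs
    exact radialMean_lineMap a hρ hc hx hs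
  have := hcomp.unique (hprod.congr_of_eventuallyEq heq)
  rw [this, hmean]
  simp [hφ]
  ring

lemma hasSmoothDivAt_radial (hρ : ContDiff ℝ ∞ ρ) (hc : HasCompactSupport ρ) (hx : x ≠ q) :
    HasSmoothDivAt (fun y => radialMean a q ρ y • (y - q)) (ρ x) x := by
  have hF := contDiffAt_radialMean a hρ hc hx
  refine ⟨hF.smul (by fun_prop), ?_⟩
  have hd : HasFDerivAt (fun y => radialMean a q ρ y • (y - q)) _ x :=
    (hF.differentiableAt (by simp)).hasFDerivAt.smul ((hasFDerivAt_id x).sub_const q)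
  have hsum : fderiv ℝ (radialMean a q ρ) x (x - q) =
      ∑ i, fderiv ℝ (radialMean a q ρ) x (Pi.single i 1) * (x - q) i := by
    conv_lhs => rw [pi_eq_sum_univ' (x - q), map_sum]
    refine Finset.sum_congr rfl fun i _ => ?_
    rw [map_smul, smul_eq_mul, mul_comm]
  rw [hd.fderiv]
  have := fderiv_radialMean a hρ hc hx
  rw [hsum] at this
  simp [Fin.sum_univ_three] at this ⊢
  linarith

end Radial

/-- A compactly supported density can be pushed away from `q` to infinity. -/
lemma exists_div_eq_outward {ρ : (Fin 3 → ℝ) → ℝ} (hρ : ContDiff ℝ ∞ ρ)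
    (hc : HasCompactSupport ρ) (q : Fin 3 → ℝ) {r : ℝ} (hr : 0 ≤ r)
    (hsupp : tsupport ρ ⊆ {x | r < ‖x - q‖}) :
    ∃ V, (∀ x, HasSmoothDivAt V (ρ x) x) ∧ ∀ x, ‖x - q‖ ≤ r → V x = 0 := by
  have hzero : ∀ x, (∀ t ∈ Ioc (0 : ℝ) 1, ρ (q + t • (x - q)) = 0) →
      radialMean 0 q ρ x • (x - q) = 0 := by
    intro x hx
    have : radialMean 0 q ρ x = 0 := by
      refine integral_eq_zero_of_ae (Eventually.of_forall fun t => ?_)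
      by_cases ht : t ∈ Ioc (0 : ℝ) 1
      · simp [hx t ht]
      · simp [radialWeight, indicator_of_notMem ht]
    rw [this, zero_smul]
  have hscale : ∀ x : Fin 3 → ℝ, ∀ t ∈ Ioc (0 : ℝ) 1,
      ‖q + t • (x - q) - q‖ ≤ ‖x - q‖ := by
    intro x t ht
    rw [add_sub_cancel_left, norm_smul, Real.norm_of_nonneg ht.1.le]
    exact mul_le_of_le_one_left (norm_nonneg _) ht.2
  refine ⟨fun y => radialMean 0 q ρ y • (y - q), fun x => ?_, fun x hx => hzero x ?_⟩
  · rcases eq_or_ne x q with rfl | hx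
    · have hmem : x ∉ tsupport ρ := fun h => by
        have := hsupp h
        simp only [mem_ofPred_eq, sub_self, norm_zero] at this
        linarith
      obtain ⟨δ, hδ, hball⟩ := Metric.eventually_nhds_iff.1
        (notMem_tsupport_iff_eventuallyEq.1 hmem)
      rw [image_eq_zero_of_notMem_tsupport hmem]
      refine HasSmoothDivAt.zero.congr_of_eventuallyEq ?_
      filter_upwards [Metric.ball_mem_nhds x hδ] with y hy
      refine hzero y fun t ht => hball ?_
      rw [dist_eq_norm]
      exact (hscale y t ht).trans_lt (by simpa [dist_eq_norm] using hy)
    · exact hasSmoothDivAt_radial 0 hρ hc hx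
  · intro t ht
    refine image_eq_zero_of_notMem_tsupport fun h => ?_
    exact absurd (hsupp h) (not_lt.2 ((hscale x t ht).trans hx))

/-- A density supported near `q` can be pushed into `q`. -/
lemma exists_div_eq_inward {ρ : (Fin 3 → ℝ) → ℝ} (hρ : ContDiff ℝ ∞ ρ)
    (hc : HasCompactSupport ρ) (q : Fin 3 → ℝ) {r : ℝ}
    (hsupp : tsupport ρ ⊆ Metric.ball q r) :
    ∃ V, (∀ x, x ≠ q → HasSmoothDivAt V (ρ x) x) ∧ ∀ x, x ∉ Metric.ball q r → V x = 0 := by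
  refine ⟨fun y => radialMean 1 q ρ y • (y - q),
    fun x hx => hasSmoothDivAt_radial 1 hρ hc hx, fun x hx => ?_⟩
  have : radialMean 1 q ρ x = 0 := by
    refine integral_eq_zero_of_ae (Eventually.of_forall fun t => ?_)
    rcases le_or_gt t 0 with h0 | h0
    · simp [radialWeight, h0.not_gt]
    rcases le_or_gt t 1 with h1 | h1
    · simp [radialWeight, h0, h1]
    have hmem : q + t • (x - q) ∉ tsupport ρ := fun h => hx <| by
      have := hsupp h
      rw [mem_ball_iff_norm, add_sub_cancel_left, norm_smul, Real.norm_of_nonneg h0.le] at this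
      rw [mem_ball_iff_norm]
      exact (le_mul_of_one_le_left (norm_nonneg _) h1.le).trans_lt this
    simp [image_eq_zero_of_notMem_tsupport hmem]
  simp only [this, zero_smul]

/-- The points of norm at most `r` at distance at least `ε` from the complement of `U`. -/
def deepSet (U : Set (Fin 3 → ℝ)) (r ε : ℝ) : Set (Fin 3 → ℝ) :=
  {x | ‖x‖ ≤ r ∧ ∀ q ∉ U, ε ≤ ‖x - q‖}

section DeepSet

variable {U : Set (Fin 3 → ℝ)} {r r' ε ε' : ℝ}

lemma isCompact_deepSet : IsCompact (deepSet U r ε) := by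
  have hclosed : IsClosed (deepSet U r ε) := by
    have : deepSet U r ε = {x | ‖x‖ ≤ r} ∩ ⋂ q ∈ Uᶜ, {x | ε ≤ ‖x - q‖} := by
      ext x
      simp [deepSet]
    rw [this]
    exact (isClosed_le continuous_norm continuous_const).inter
      (isClosed_biInter fun q _ => isClosed_le continuous_const (by fun_prop))
  exact (isCompact_closedBall (0 : Fin 3 → ℝ) r).of_isClosed_subset hclosed
    fun x hx => mem_closedBall_zero_iff.2 hx.1

lemma deepSet_subset (hε : 0 < ε) : deepSet U r ε ⊆ U := by
  intro x hx
  by_contra h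
  have := hx.2 x h
  rw [sub_self, norm_zero] at this
  linarith

lemma deepSet_subset_interior (hr : r < r') (hε : ε' < ε) :
    deepSet U r ε ⊆ interior (deepSet U r' ε') := by
  intro x hx
  rw [mem_interior_iff_mem_nhds]
  filter_upwards [Metric.ball_mem_nhds x (sub_pos.2 hr), Metric.ball_mem_nhds x (sub_pos.2 hε)]
    with y hy hy'
  rw [mem_ball_iff_norm] at hy hy'
  refine ⟨?_, fun q hq => ?_⟩
  · have := norm_le_norm_add_norm_sub' y x
    linarith [hx.1]
  · have h1 := norm_sub_le_norm_sub_add_norm_sub x y q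
    rw [norm_sub_rev x y] at h1
    linarith [hx.2 q hq]

lemma exists_mem_deepSet (hU : IsOpen U) {x : Fin 3 → ℝ} (hx : x ∈ U) :
    ∃ n : ℕ, x ∈ deepSet U (n + 1) (1 / (n + 1)) := by
  obtain ⟨δ, hδ, hball⟩ := Metric.isOpen_iff.1 hU x hx
  obtain ⟨m, hm⟩ := exists_nat_gt ‖x‖
  obtain ⟨k, hk⟩ := exists_nat_one_div_lt hδ
  refine ⟨max m k, ?_, fun q hq => ?_⟩
  · have : (m : ℝ) ≤ (max m k : ℕ) := by exact_mod_cast le_max_left m k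
    linarith
  · have h1 : δ ≤ ‖x - q‖ := by
      by_contra! h
      exact hq (hball (by rwa [mem_ball_iff_norm, norm_sub_rev]))
    exact (Nat.one_div_le_one_div (le_max_right m k)).trans (hk.le.trans h1)

/-- A compactly supported density away from a deep set can be pushed out of `U` without
crossing that deep set. -/
lemma exists_div_eq_avoiding_deepSet {σ : (Fin 3 → ℝ) → ℝ} (hσ : ContDiff ℝ ∞ σ)
    (hc : HasCompactSupport σ) (hr : 0 ≤ r) (hd : Disjoint (tsupport σ) (deepSet U r ε)) :
    ∃ V, (∀ x ∈ U, HasSmoothDivAt V (σ x) x) ∧ ∀ x ∈ deepSet U r ε, V x = 0 := by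
  let W : Option (Uᶜ : Set (Fin 3 → ℝ)) → Set (Fin 3 → ℝ) := fun i =>
    i.elim {x | r < ‖x - 0‖} fun q => Metric.ball q ε
  have hWo : ∀ i, IsOpen (W i) := by
    rintro (_ | q)
    · exact isOpen_lt continuous_const (by fun_prop)
    · exact Metric.isOpen_ball
  have hcover : tsupport σ ⊆ ⋃ i, W i := by
    intro x hx
    by_contra hnot
    simp only [mem_iUnion, not_exists] at hnot
    refine disjoint_left.1 hd hx ⟨?_, fun q hq => ?_⟩
    · simpa [W] using hnot none
    · simpa [W, dist_eq_norm] using hnot (some ⟨q, hq⟩)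
  obtain ⟨f, hf⟩ := SmoothPartitionOfUnity.exists_isSubordinate 𝓘(ℝ, Fin 3 → ℝ)
    (isClosed_tsupport σ) W hWo hcover
  have hpiece : ∀ i, ∃ V, (∀ x ∈ U, HasSmoothDivAt V (f i x * σ x) x) ∧
      ∀ x ∈ deepSet U r ε, V x = 0 := by
    intro i
    have hsm : ContDiff ℝ ∞ fun x => f i x * σ x := (f i).contMDiff.contDiff.mul hσ
    have hcs : HasCompactSupport fun x => f i x * σ x := hc.mul_left
    have hsub : (tsupport fun x => f i x * σ x) ⊆ W i :=
      (tsupport_mul_subset_left).trans (hf i)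
    match i with
    | none =>
      obtain ⟨V, hV, hV0⟩ := exists_div_eq_outward hsm hcs 0 hr hsub
      exact ⟨V, fun x _ => hV x, fun x hx => hV0 x (by simpa using hx.1)⟩
    | some q =>
      obtain ⟨V, hV, hV0⟩ := exists_div_eq_inward hsm hcs (q : Fin 3 → ℝ) hsub
      refine ⟨V, fun x hx => hV x fun h => q.2 (h ▸ hx), fun x hx => hV0 x ?_⟩
      rw [mem_ball_iff_norm]
      exact not_lt.2 (hx.2 q q.2)
  choose V hV hV0 using hpiece
  have hfin := f.locallyFinite.finite_nonempty_inter_compact hc.isCompact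
  refine ⟨fun x => ∑ i ∈ hfin.toFinset, V i x, fun x hx => ?_, fun x hx =>
    Finset.sum_eq_zero fun i _ => hV0 i x hx⟩
  have hsum : ∑ i ∈ hfin.toFinset, f i x * σ x = σ x := by
    by_cases hxs : x ∈ tsupport σ
    · rw [← Finset.sum_mul, ← finsum_eq_sum_of_support_subset, f.sum_eq_one hxs, one_mul]
      intro i hi
      simpa using ⟨x, hi, hxs⟩
    · simp [image_eq_zero_of_notMem_tsupport hxs]
  rw [← hsum]
  exact HasSmoothDivAt.sum fun i _ => hV i x hx

end DeepSet

/-- The divergence is surjective on smooth vector fields on any open subset of `ℝ³`. -/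
theorem exists_div_eq_of_isOpen {U : Set (Fin 3 → ℝ)} (hU : IsOpen U) {ρ : (Fin 3 → ℝ) → ℝ}
    (hρ : ContDiffOn ℝ ∞ ρ U) : ∃ V, ∀ x ∈ U, HasSmoothDivAt V (ρ x) x := by
  let K : ℕ → Set (Fin 3 → ℝ) := fun n => deepSet U (n + 1) (1 / (n + 1))
  have hKU : ∀ n, K n ⊆ U := fun n => deepSet_subset (by positivity)
  have hKint : ∀ n, K n ⊆ interior (K (n + 1)) := fun n =>
    deepSet_subset_interior (by push_cast; linarith)
      (by push_cast; exact one_div_lt_one_div_of_lt (by positivity) (by linarith))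
  have hKmono : Monotone K := monotone_nat_of_le_succ fun n => (hKint n).trans interior_subset
  have hχ : ∀ n, ∃ χ : (Fin 3 → ℝ) → ℝ, ContDiff ℝ ∞ χ ∧ (∀ᶠ x in 𝓝ˢ (K n), χ x = 1) ∧
      tsupport χ ⊆ K (n + 1) := by
    intro n
    obtain ⟨χ, h1, h0, -⟩ := exists_contMDiffMap_one_nhds_of_subset_interior (n := ⊤)
      𝓘(ℝ, Fin 3 → ℝ) isCompact_deepSet.isClosed (hKint n)
    refine ⟨χ, χ.contMDiff.contDiff, h1, closure_minimal ?_ isCompact_deepSet.isClosed⟩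
    intro x hx
    by_contra h
    exact hx (h0 x h)
  choose χ hχs hχ1 hχK using hχ
  have hχρ : ∀ n, ContDiff ℝ ∞ fun x => χ n x * ρ x := by
    refine fun n => contDiff_iff_contDiffAt.2 fun x => ?_
    by_cases hx : x ∈ tsupport (χ n)
    · exact (hχs n).contDiffAt.mul
        (hρ.contDiffAt (hU.mem_nhds (hKU _ (hχK n hx))))
    · refine (contDiffAt_const (c := (0 : ℝ))).congr_of_eventuallyEq ?_
      filter_upwards [notMem_tsupport_iff_eventuallyEq.1 hx] with y hy
      simp [hy]
  have hχc : ∀ n, HasCompactSupport fun x => χ n x * ρ x := fun n =>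
    HasCompactSupport.mul_right
      (isCompact_deepSet.of_isClosed_subset (isClosed_tsupport _) (hχK n))
  obtain ⟨V₀, hV₀⟩ : ∃ V, ∀ x, HasSmoothDivAt V (χ 0 x * ρ x) x := by
    obtain ⟨q, hq⟩ : ∃ q, q ∉ tsupport fun x => χ 0 x * ρ x := by
      by_contra! h
      exact (hχc 0).isCompact.ne_univ (eq_univ_of_forall h)
    obtain ⟨V, hV, -⟩ := exists_div_eq_outward (hχρ 0) (hχc 0) q le_rfl fun x hx =>
      norm_pos_iff.2 (sub_ne_zero.2 fun h => hq (h ▸ hx))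
    exact ⟨V, hV⟩
  have hstep : ∀ n, ∃ V, (∀ x ∈ U, HasSmoothDivAt V (χ (n + 1) x * ρ x - χ n x * ρ x) x) ∧
      ∀ x ∈ K n, V x = 0 := by
    intro n
    refine exists_div_eq_avoiding_deepSet ((hχρ (n + 1)).sub (hχρ n))
      ((hχc (n + 1)).sub (hχc n)) (by positivity) (disjoint_right.2 fun x hx => ?_)
    rw [notMem_tsupport_iff_eventuallyEq]
    filter_upwards [eventually_nhdsSet_iff_forall.1 (hχ1 n) x hx,
      eventually_nhdsSet_iff_forall.1 (hχ1 (n + 1)) x (hKmono n.le_succ hx)] with y h1 h2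
    simp [h1, h2]
  choose V hV hV0 using hstep
  refine ⟨fun x => V₀ x + ∑ᶠ n, V n x, fun x hx => ?_⟩
  obtain ⟨m, hm⟩ := exists_mem_deepSet hU hx
  have hfinite := (hV₀ x).add (HasSmoothDivAt.sum (s := Finset.range (m + 1)) fun n _ => hV n x hx)
  rw [Finset.sum_range_sub (fun n => χ n x * ρ x), add_sub_cancel,
    (hχ1 (m + 1)).self_of_nhdsSet _ (hKmono m.le_succ hm), one_mul] at hfinite
  refine hfinite.congr_of_eventuallyEq ?_
  filter_upwards [mem_interior_iff_mem_nhds.1 (hKint m hm)] with y hy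
  congr 1
  refine finsum_eq_sum_of_support_subset _ fun n hn => ?_
  by_contra hlt
  refine hn (hV0 n y (hKmono ?_ hy))
  simpa using hlt

section Martinet

variable {f : (Fin 3 → ℝ) → ℝ} {p : Fin 3 → ℝ}

lemma contDiffAt_opX (hf : ContDiffAt ℝ ∞ f p) : ContDiffAt ℝ ∞ (opX f) p :=
  (hf.fderiv_right (by simp)).clm_apply contDiffAt_const

lemma contDiff_vecY : ContDiff ℝ ∞ fun p : Fin 3 → ℝ => ![0, (p 0) ^ 2, 1] := by
  rw [contDiff_pi]
  intro i
  fin_cases i <;> simp <;> fun_prop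

lemma contDiff_vecZ : ContDiff ℝ ∞ fun p : Fin 3 → ℝ => ![0, 2 * p 0, 0] := by
  rw [contDiff_pi]
  intro i
  fin_cases i <;> simp <;> fun_prop

lemma contDiffAt_opY (hf : ContDiffAt ℝ ∞ f p) : ContDiffAt ℝ ∞ (opY f) p :=
  (hf.fderiv_right (by simp)).clm_apply contDiff_vecY.contDiffAt

lemma contDiffAt_opZ (hf : ContDiffAt ℝ ∞ f p) : ContDiffAt ℝ ∞ (opZ f) p :=
  (hf.fderiv_right (by simp)).clm_apply contDiff_vecZ.contDiffAt

/-- The commutator of `X` with the derivation along a vector field `B`. -/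
lemma opX_comm_of_vectorField {B : (Fin 3 → ℝ) → Fin 3 → ℝ} (hf : ContDiffAt ℝ ∞ f p)
    (hB : ContDiff ℝ ∞ B) :
    opX (fun q => fderiv ℝ f q (B q)) p - fderiv ℝ (opX f) p (B p) =
      fderiv ℝ f p fun i => fderiv ℝ (fun q => B q i) p ![1, 0, 0] := by
  have h2 : ContDiffAt ℝ 2 f p := hf.of_le (WithTop.coe_le_coe.2 le_top)
  have hBd : DifferentiableAt ℝ B p := hB.contDiffAt.differentiableAt (by simp)
  have key := VectorField.fderiv_apply_lieBracket_of_isSymmSndFDerivAt h2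
    (h2.isSymmSndFDerivAt (by simp)) hBd (differentiableAt_const (![1, 0, 0] : Fin 3 → ℝ))
  refine key.symm.trans (congrArg _ ?_)
  ext i
  simp [VectorField.lieBracket, fderiv_apply hBd]

/-- `[X, Y] = Z`. -/
lemma opX_opY_sub_opY_opX (hf : ContDiffAt ℝ ∞ f p) :
    opX (opY f) p - opY (opX f) p = opZ f p := by
  refine (opX_comm_of_vectorField hf contDiff_vecY).trans (congrArg _ ?_)
  have h : HasFDerivAt (fun p : Fin 3 → ℝ => (p 0) ^ 2) _ p :=
    (hasFDerivAt_apply (𝕜 := ℝ) (0 : Fin 3) p).pow 2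
  ext i
  fin_cases i <;> simp [h.fderiv]

/-- `[X, Z] = W`. -/
lemma opX_opZ_sub_opZ_opX (hf : ContDiffAt ℝ ∞ f p) :
    opX (opZ f) p - opZ (opX f) p = opW f p := by
  refine (opX_comm_of_vectorField hf contDiff_vecZ).trans (congrArg _ ?_)
  have h : HasFDerivAt (fun p : Fin 3 → ℝ => 2 * p 0) _ p :=
    (hasFDerivAt_apply (𝕜 := ℝ) (0 : Fin 3) p).const_mul 2
  ext i
  fin_cases i <;> simp [h.fderiv]

/-- The field `W / 2 = ∂/∂y` is a second-order expression in the horizontal fields. -/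
lemma opX_sub_opY_eq_opW (hf : ContDiffAt ℝ ∞ f p) :
    opX (fun q => opZ f q - opY (opX f) q) p + opY (opX (opX f)) p = opW f p := by
  have hX := contDiffAt_opX hf
  have hsub : opX (fun q => opZ f q - opY (opX f) q) p =
      opX (opZ f) p - opX (opY (opX f)) p := by
    rw [opX, fderiv_fun_sub ((contDiffAt_opZ hf).differentiableAt (by simp))
      ((contDiffAt_opY hX).differentiableAt (by simp))]
    rfl
  linarith [opX_opY_sub_opY_opX hX, opX_opZ_sub_opZ_opX hf]

end Martinet

theorem martinet_exact_final
    (U : Set (Fin 3 → ℝ)) (hU : IsOpen U) (hUc : ContractibleSpace U)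
    (ρ : (Fin 3 → ℝ) → ℝ) (hρ : ContDiffOn ℝ (⊤ : ℕ∞) ρ U) :
    ∃ g h : (Fin 3 → ℝ) → ℝ, ContDiffOn ℝ (⊤ : ℕ∞) g U ∧ ContDiffOn ℝ (⊤ : ℕ∞) h U ∧
      ∀ p ∈ U, opX h p - opY g p = ρ p := by
  obtain ⟨V, hV⟩ := exists_div_eq_of_isOpen hU hρ
  have hVi : ∀ p ∈ U, ∀ i, ContDiffAt ℝ ∞ (fun q => V q i) p := fun p hp i =>
    contDiffAt_pi.1 (hV p hp).1 i
  set c : (Fin 3 → ℝ) → ℝ := fun q => V q 1 - q 0 ^ 2 * V q 2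
  have hc : ∀ p ∈ U, ContDiffAt ℝ ∞ c p := fun p hp =>
    (hVi p hp 1).sub (ContDiffAt.mul (by fun_prop) (hVi p hp 2))
  set k : (Fin 3 → ℝ) → ℝ := fun q => opZ c q - opY (opX c) q
  have hk : ∀ p ∈ U, ContDiffAt ℝ ∞ k p := fun p hp =>
    (contDiffAt_opZ (hc p hp)).sub (contDiffAt_opY (contDiffAt_opX (hc p hp)))
  have hXX : ∀ p ∈ U, ContDiffAt ℝ ∞ (opX (opX c)) p := fun p hp =>
    contDiffAt_opX (contDiffAt_opX (hc p hp))
  refine ⟨fun q => -V q 2 - 1 / 2 * opX (opX c) q, fun q => V q 0 + 1 / 2 * k q,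
    fun p hp => ((hVi p hp 2).neg.sub (contDiffAt_const.mul (hXX p hp))).contDiffWithinAt,
    fun p hp => ((hVi p hp 0).add (contDiffAt_const.mul (hk p hp))).contDiffWithinAt,
    fun p hp => ?_⟩
  have hVd := (hV p hp).1.differentiableAt (by simp)
  have hD : ∀ i, HasFDerivAt (fun q => V q i) (fderiv ℝ (fun q => V q i) p) p := fun i =>
    ((hVi p hp i).differentiableAt (by simp)).hasFDerivAt
  have hkd := ((hk p hp).differentiableAt (by simp)).hasFDerivAt
  have hXXd := ((hXX p hp).differentiableAt (by simp)).hasFDerivAt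
  have hh := (hD 0).fun_add (hkd.const_mul (1 / 2))
  have hg := (hD 2).fun_neg.fun_sub (hXXd.const_mul (1 / 2))
  have hcd := (hD 1).sub (((hasFDerivAt_apply (𝕜 := ℝ) (0 : Fin 3) p).pow 2).mul (hD 2))
  have hdiv := (hV p hp).2
  have hW := opX_sub_opY_eq_opW (hc p hp)
  have hcoord : ∀ i, fderiv ℝ V p (Pi.single i 1) i =
      fderiv ℝ (fun q => V q i) p (Pi.single i 1) := fun i => by
    rw [fderiv_apply hVd]
    rfl
  have hWc : opW c p = 2 * (fderiv ℝ (fun q => V q 1) p (Pi.single 1 1) -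
      p 0 ^ 2 * fderiv ℝ (fun q => V q 2) p (Pi.single 1 1)) := by
    have hvec : (![0, 2, 0] : Fin 3 → ℝ) = (2 : ℝ) • Pi.single 1 1 := by
      ext i
      fin_cases i <;> simp
    rw [opW, hvec, map_smul, HasFDerivAt.fderiv (f := c) hcd]
    simp
  have hX : (![1, 0, 0] : Fin 3 → ℝ) = Pi.single 0 1 := by
    ext i
    fin_cases i <;> simp
  have hY : (![0, p 0 ^ 2, 1] : Fin 3 → ℝ) =
      p 0 ^ 2 • Pi.single 1 1 + Pi.single 2 1 := by
    ext i
    fin_cases i <;> simp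
  have hXh : opX (fun q => V q 0 + 1 / 2 * k q) p =
      fderiv ℝ (fun q => V q 0) p (Pi.single 0 1) + 1 / 2 * opX k p := by
    rw [opX, hh.fderiv, opX, hX]
    rfl
  have hYg : opY (fun q => -V q 2 - 1 / 2 * opX (opX c) q) p =
      -(p 0 ^ 2 * fderiv ℝ (fun q => V q 2) p (Pi.single 1 1) +
        fderiv ℝ (fun q => V q 2) p (Pi.single 2 1)) - 1 / 2 * opY (opX (opX c)) p := by
    rw [opY, hg.fderiv, opY, ← smul_eq_mul (p 0 ^ 2), ← map_smul, ← map_add, ← hY]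
    rfl
  rw [Fin.sum_univ_three, hcoord, hcoord, hcoord] at hdiv
  rw [hXh, hYg]
  linarith
end

section
/- Let U ⊆ ℝ³ be an open set. The Martinet sequence of operators is a complex: for every smooth f : U → ℝ one has X³(Yf) − (X²Y + XZ + W)(Xf) = 0 and Y²(Xf) − (YX − Z)(Yf) = 0 on U; for all smooth a, b : U → ℝ, setting c = X³b − (X²Y + XZ + W)a and d = Y²a − (YX − Z)b, one has X³d + (XY + Z)c = 0 and Y²c + (YX² − ZX + W)d = 0 on U; and for all smooth c, d : U → ℝ, setting g = X³d + (XY + Z)c and h = Y²c + (YX² − ZX + W)d, one has Xh − Yg = 0 on U. -/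
open Filter Topology
open scoped ContDiff

/-- Derivative of `f` along the vector field `v`. -/
noncomputable def derivAlong (v : (Fin 3 → ℝ) → Fin 3 → ℝ) (f : (Fin 3 → ℝ) → ℝ) :
    (Fin 3 → ℝ) → ℝ :=
  fun p => fderiv ℝ f p (v p)

section derivAlong

variable {v w : (Fin 3 → ℝ) → Fin 3 → ℝ} {f g : (Fin 3 → ℝ) → ℝ} {p : Fin 3 → ℝ}

theorem derivAlong_contDiff (hv : ContDiff ℝ ∞ v) (hf : ContDiff ℝ ∞ f) :
    ContDiff ℝ ∞ (derivAlong v f) :=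
  (hf.fderiv_right (m := ∞) (by simp)).clm_apply hv

theorem derivAlong_add (hf : ContDiff ℝ ∞ f) (hg : ContDiff ℝ ∞ g) :
    derivAlong v (f + g) = derivAlong v f + derivAlong v g := by
  funext q
  simp only [derivAlong, Pi.add_apply]
  rw [fderiv_add (hf.differentiable (by simp) q) (hg.differentiable (by simp) q)]
  rfl

theorem derivAlong_sub (hf : ContDiff ℝ ∞ f) (hg : ContDiff ℝ ∞ g) :
    derivAlong v (f - g) = derivAlong v f - derivAlong v g := by
  funext q
  simp only [derivAlong, Pi.sub_apply]
  rw [fderiv_sub (hf.differentiable (by simp) q) (hg.differentiable (by simp) q)]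
  rfl

theorem derivAlong_congr (h : f =ᶠ[𝓝 p] g) : derivAlong v f =ᶠ[𝓝 p] derivAlong v g := by
  filter_upwards [h.fderiv (𝕜 := ℝ)] with q hq
  simp only [derivAlong, hq]

theorem derivAlong_derivAlong (hw : ContDiff ℝ ∞ w) (hf : ContDiff ℝ ∞ f) (p : Fin 3 → ℝ) :
    derivAlong v (derivAlong w f) p =
      fderiv ℝ (fderiv ℝ f) p (v p) (w p) + fderiv ℝ f p (fderiv ℝ w p (v p)) := by
  have hf' : DifferentiableAt ℝ (fderiv ℝ f) p :=
    (hf.fderiv_right (m := ∞) (by simp)).differentiable (by simp) p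
  have h := fderiv_clm_apply hf' (hw.differentiable (by simp) p)
  change fderiv ℝ (fun y => fderiv ℝ f y (w y)) p (v p) = _
  rw [h]
  simp [add_comm]

theorem derivAlong_comm (hv : ContDiff ℝ ∞ v) (hw : ContDiff ℝ ∞ w) (hf : ContDiff ℝ ∞ f) :
    derivAlong v (derivAlong w f) = fun q => derivAlong w (derivAlong v f) q +
      fderiv ℝ f q (fderiv ℝ w q (v q) - fderiv ℝ v q (w q)) := by
  funext q
  have hs : IsSymmSndFDerivAt ℝ f q :=
    hf.contDiffAt.isSymmSndFDerivAt (by simpa using WithTop.coe_le_coe.2 (le_top (a := (2 : ℕ∞))))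
  rw [derivAlong_derivAlong hw hf, derivAlong_derivAlong hv hf, hs.eq, map_sub]
  ring

end derivAlong

section Martinet

variable {f g : (Fin 3 → ℝ) → ℝ} {p : Fin 3 → ℝ}

theorem vecCons_three_zero : (![0, 0, 0] : Fin 3 → ℝ) = 0 := by
  simp

theorem contDiff_vecCons_three {a b c : (Fin 3 → ℝ) → ℝ} (ha : ContDiff ℝ ∞ a)
    (hb : ContDiff ℝ ∞ b) (hc : ContDiff ℝ ∞ c) :
    ContDiff ℝ ∞ (fun p => ![a p, b p, c p]) := by
  rw [contDiff_pi]
  intro i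
  fin_cases i
  exacts [ha, hb, hc]

theorem contDiff_fieldX : ContDiff ℝ ∞ (fun _ : Fin 3 → ℝ => (![1, 0, 0] : Fin 3 → ℝ)) :=
  contDiff_const

theorem contDiff_fieldY :
    ContDiff ℝ ∞ (fun p : Fin 3 → ℝ => (![0, (p 0) ^ 2, 1] : Fin 3 → ℝ)) :=
  contDiff_vecCons_three contDiff_const (by fun_prop) contDiff_const

theorem contDiff_fieldZ :
    ContDiff ℝ ∞ (fun p : Fin 3 → ℝ => (![0, 2 * p 0, 0] : Fin 3 → ℝ)) :=
  contDiff_vecCons_three contDiff_const (by fun_prop) contDiff_const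

theorem contDiff_fieldW : ContDiff ℝ ∞ (fun _ : Fin 3 → ℝ => (![0, 2, 0] : Fin 3 → ℝ)) :=
  contDiff_const

theorem fderiv_fieldY (p u : Fin 3 → ℝ) :
    fderiv ℝ (fun p : Fin 3 → ℝ => (![0, (p 0) ^ 2, 1] : Fin 3 → ℝ)) p u =
      ![0, 2 * p 0 * u 0, 0] := by
  have h0 : HasFDerivAt (fun q : Fin 3 → ℝ => q 0)
      (ContinuousLinearMap.proj (R := ℝ) (φ := fun _ : Fin 3 => ℝ) 0) p := hasFDerivAt_apply 0 p
  funext i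
  have h := fderiv_apply (contDiff_fieldY.differentiable (by simp) p) i
  refine (DFunLike.congr_fun h u).symm.trans ?_
  fin_cases i
  · simp
  · simp [(h0.pow 2).fderiv]
  · simp

theorem fderiv_fieldZ (p u : Fin 3 → ℝ) :
    fderiv ℝ (fun p : Fin 3 → ℝ => (![0, 2 * p 0, 0] : Fin 3 → ℝ)) p u = ![0, 2 * u 0, 0] := by
  have h0 : HasFDerivAt (fun q : Fin 3 → ℝ => q 0)
      (ContinuousLinearMap.proj (R := ℝ) (φ := fun _ : Fin 3 => ℝ) 0) p := hasFDerivAt_apply 0 p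
  funext i
  have h := fderiv_apply (contDiff_fieldZ.differentiable (by simp) p) i
  refine (DFunLike.congr_fun h u).symm.trans ?_
  fin_cases i
  · simp
  · simp [(h0.const_mul 2).fderiv]
  · simp

theorem opX_contDiff (hf : ContDiff ℝ ∞ f) : ContDiff ℝ ∞ (opX f) :=
  derivAlong_contDiff contDiff_fieldX hf

theorem opY_contDiff (hf : ContDiff ℝ ∞ f) : ContDiff ℝ ∞ (opY f) :=
  derivAlong_contDiff contDiff_fieldY hf

theorem opZ_contDiff (hf : ContDiff ℝ ∞ f) : ContDiff ℝ ∞ (opZ f) :=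
  derivAlong_contDiff contDiff_fieldZ hf

theorem opW_contDiff (hf : ContDiff ℝ ∞ f) : ContDiff ℝ ∞ (opW f) :=
  derivAlong_contDiff contDiff_fieldW hf

theorem contDiff_pi_add (hf : ContDiff ℝ ∞ f) (hg : ContDiff ℝ ∞ g) : ContDiff ℝ ∞ (f + g) :=
  hf.add hg

theorem contDiff_pi_sub (hf : ContDiff ℝ ∞ f) (hg : ContDiff ℝ ∞ g) : ContDiff ℝ ∞ (f - g) :=
  hf.sub hg

theorem opX_add (hf : ContDiff ℝ ∞ f) (hg : ContDiff ℝ ∞ g) :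
    opX (f + g) = opX f + opX g := derivAlong_add hf hg

theorem opY_add (hf : ContDiff ℝ ∞ f) (hg : ContDiff ℝ ∞ g) :
    opY (f + g) = opY f + opY g := derivAlong_add hf hg

theorem opZ_add (hf : ContDiff ℝ ∞ f) (hg : ContDiff ℝ ∞ g) :
    opZ (f + g) = opZ f + opZ g := derivAlong_add hf hg

theorem opX_sub (hf : ContDiff ℝ ∞ f) (hg : ContDiff ℝ ∞ g) :
    opX (f - g) = opX f - opX g := derivAlong_sub hf hg

theorem opY_sub (hf : ContDiff ℝ ∞ f) (hg : ContDiff ℝ ∞ g) :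
    opY (f - g) = opY f - opY g := derivAlong_sub hf hg

theorem opZ_sub (hf : ContDiff ℝ ∞ f) (hg : ContDiff ℝ ∞ g) :
    opZ (f - g) = opZ f - opZ g := derivAlong_sub hf hg

theorem opW_sub (hf : ContDiff ℝ ∞ f) (hg : ContDiff ℝ ∞ g) :
    opW (f - g) = opW f - opW g := derivAlong_sub hf hg

theorem opX_congr (h : f =ᶠ[𝓝 p] g) : opX f =ᶠ[𝓝 p] opX g := derivAlong_congr h

theorem opY_congr (h : f =ᶠ[𝓝 p] g) : opY f =ᶠ[𝓝 p] opY g := derivAlong_congr h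

theorem opZ_congr (h : f =ᶠ[𝓝 p] g) : opZ f =ᶠ[𝓝 p] opZ g := derivAlong_congr h

theorem opW_congr (h : f =ᶠ[𝓝 p] g) : opW f =ᶠ[𝓝 p] opW g := derivAlong_congr h

theorem opY_opX (hf : ContDiff ℝ ∞ f) : opY (opX f) = opX (opY f) - opZ f := by
  refine (derivAlong_comm contDiff_fieldY contDiff_fieldX hf).trans (funext fun q => ?_)
  rw [fderiv_fieldY, ← neg_sub, map_neg, ← sub_eq_add_neg]
  simp
  rfl

theorem opZ_opX (hf : ContDiff ℝ ∞ f) : opZ (opX f) = opX (opZ f) - opW f := by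
  refine (derivAlong_comm contDiff_fieldZ contDiff_fieldX hf).trans (funext fun q => ?_)
  rw [fderiv_fieldZ, ← neg_sub, map_neg, ← sub_eq_add_neg]
  simp
  rfl

theorem opZ_opY (hf : ContDiff ℝ ∞ f) : opZ (opY f) = opY (opZ f) := by
  refine (derivAlong_comm contDiff_fieldZ contDiff_fieldY hf).trans (funext fun q => ?_)
  rw [fderiv_fieldZ, fderiv_fieldY]
  simp
  rfl

theorem opW_opX (hf : ContDiff ℝ ∞ f) : opW (opX f) = opX (opW f) := by
  refine (derivAlong_comm contDiff_fieldW contDiff_fieldX hf).trans (funext fun q => ?_)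
  simp
  rfl

theorem opW_opY (hf : ContDiff ℝ ∞ f) : opW (opY f) = opY (opW f) := by
  refine (derivAlong_comm contDiff_fieldW contDiff_fieldY hf).trans (funext fun q => ?_)
  rw [fderiv_fieldY]
  simp [vecCons_three_zero]
  rfl

theorem opW_opZ (hf : ContDiff ℝ ∞ f) : opW (opZ f) = opZ (opW f) := by
  refine (derivAlong_comm contDiff_fieldW contDiff_fieldZ hf).trans (funext fun q => ?_)
  rw [fderiv_fieldZ]
  simp [vecCons_three_zero]
  rfl

end Martinet

/-- A function smooth on an open set agrees near each of its points with a globally smooth one. -/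
theorem exists_contDiff_eventuallyEq {U : Set (Fin 3 → ℝ)} (hU : IsOpen U)
    {f : (Fin 3 → ℝ) → ℝ} (hf : ContDiffOn ℝ ∞ f U) {p : Fin 3 → ℝ} (hp : p ∈ U) :
    ∃ g : (Fin 3 → ℝ) → ℝ, ContDiff ℝ ∞ g ∧ f =ᶠ[𝓝 p] g := by
  obtain ⟨r, hr, hrU⟩ := Metric.nhds_basis_closedBall.mem_iff.1 (hU.mem_nhds hp)
  let φ : ContDiffBump p := ⟨r / 2, r, by positivity, by linarith⟩
  refine ⟨fun q => φ q * f q, contDiff_iff_contDiffAt.2 fun q => ?_, ?_⟩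
  · by_cases hq : q ∈ U
    · exact φ.contDiff.contDiffAt.mul (hf.contDiffAt (hU.mem_nhds hq))
    · have hq' : q ∉ tsupport φ := by
        rw [φ.tsupport_eq]
        exact fun h => hq (hrU h)
      refine (contDiffAt_const (c := (0 : ℝ))).congr_of_eventuallyEq ?_
      filter_upwards [notMem_tsupport_iff_eventuallyEq.1 hq'] with y hy
      simp [hy]
  · filter_upwards [φ.eventuallyEq_one] with q hq
    simp [hq]

theorem martinet_is_complex
    (U : Set (Fin 3 → ℝ)) (hU : IsOpen U) :
    (∀ f : (Fin 3 → ℝ) → ℝ, ContDiffOn ℝ (⊤ : ℕ∞) f U →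
      ∀ p ∈ U,
        opX (opX (opX (opY f))) p -
          (opX (opX (opY (opX f))) p + opX (opZ (opX f)) p + opW (opX f) p)
          = 0 ∧
        opY (opY (opX f)) p - (opY (opX (opY f)) p - opZ (opY f) p) = 0) ∧
    (∀ a b : (Fin 3 → ℝ) → ℝ, ContDiffOn ℝ (⊤ : ℕ∞) a U → ContDiffOn ℝ (⊤ : ℕ∞) b U →
      ∀ c d : (Fin 3 → ℝ) → ℝ,
      c = (fun q => opX (opX (opX b)) q -
            (opX (opX (opY a)) q + opX (opZ a) q + opW a q)) →
      d = (fun q => opY (opY a) q - (opY (opX b) q - opZ b q)) →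
      ∀ p ∈ U,
        opX (opX (opX d)) p + (opX (opY c) p + opZ c p) = 0 ∧
        opY (opY c) p +
          (opY (opX (opX d)) p - opZ (opX d) p + opW d p) = 0) ∧
    (∀ c d : (Fin 3 → ℝ) → ℝ, ContDiffOn ℝ (⊤ : ℕ∞) c U → ContDiffOn ℝ (⊤ : ℕ∞) d U →
      ∀ g h : (Fin 3 → ℝ) → ℝ,
      g = (fun q => opX (opX (opX d)) q + (opX (opY c) q + opZ c q)) →
      h = (fun q => opY (opY c) q +
            (opY (opX (opX d)) q - opZ (opX d) q + opW d q)) →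
      ∀ p ∈ U, opX h p - opY g p = 0) := by
  refine ⟨fun f hf p hp => ?_, ?_, ?_⟩
  · obtain ⟨f', hf', e⟩ := exists_contDiff_eventuallyEq hU hf hp
    have eX := opX_congr e
    have eY := opY_congr e
    rw [(opX_congr (opX_congr (opX_congr eY))).eq_of_nhds,
      (opX_congr (opX_congr (opY_congr eX))).eq_of_nhds,
      (opX_congr (opZ_congr eX)).eq_of_nhds, (opW_congr eX).eq_of_nhds,
      (opY_congr (opY_congr eX)).eq_of_nhds, (opY_congr (opX_congr eY)).eq_of_nhds,
      (opZ_congr eY).eq_of_nhds]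
    constructor <;>
    · simp (maxDischargeDepth := 20) only [Pi.sub_apply, opY_opX, opZ_opX, opZ_opY, opW_opX, opX_sub,
        opY_sub, opX_contDiff, opY_contDiff, opZ_contDiff, opW_contDiff, hf']
      ring
  · rintro a b ha hb c d rfl rfl p hp
    obtain ⟨a', ha', ea⟩ := exists_contDiff_eventuallyEq hU ha hp
    obtain ⟨b', hb', eb⟩ := exists_contDiff_eventuallyEq hU hb hp
    have ec := (opX_congr (opX_congr (opX_congr eb))).sub
      (((opX_congr (opX_congr (opY_congr ea))).add (opX_congr (opZ_congr ea))).add (opW_congr ea))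
    have ed := (opY_congr (opY_congr ea)).sub ((opY_congr (opX_congr eb)).sub (opZ_congr eb))
    have e₁ := (opX_congr (opX_congr (opX_congr ed))).add
      ((opX_congr (opY_congr ec)).add (opZ_congr ec))
    have e₂ := (opY_congr (opY_congr ec)).add
      (((opY_congr (opX_congr (opX_congr ed))).sub (opZ_congr (opX_congr ed))).add (opW_congr ed))
    refine ⟨e₁.eq_of_nhds.trans ?_, e₂.eq_of_nhds.trans ?_⟩ <;>
    · simp (maxDischargeDepth := 20) only [Pi.add_apply, Pi.sub_apply, opY_opX, opZ_opX, opZ_opY, opW_opX,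
        opW_opY, opW_opZ, opX_sub, opY_sub, opZ_sub, opW_sub, opX_add, opY_add, opZ_add,
        opX_contDiff, opY_contDiff, opZ_contDiff, opW_contDiff, contDiff_pi_add, contDiff_pi_sub,
        ha', hb']
      ring
  · rintro c d hc hd g h rfl rfl p hp
    obtain ⟨c', hc', ec⟩ := exists_contDiff_eventuallyEq hU hc hp
    obtain ⟨d', hd', ed⟩ := exists_contDiff_eventuallyEq hU hd hp
    have eg := (opX_congr (opX_congr (opX_congr ed))).add
      ((opX_congr (opY_congr ec)).add (opZ_congr ec))
    have eh := (opY_congr (opY_congr ec)).add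
      (((opY_congr (opX_congr (opX_congr ed))).sub (opZ_congr (opX_congr ed))).add (opW_congr ed))
    refine ((opX_congr eh).sub (opY_congr eg)).eq_of_nhds.trans ?_
    simp (maxDischargeDepth := 20) only [Pi.add_apply, Pi.sub_apply, opY_opX, opZ_opX, opZ_opY,
      opW_opX, opX_sub, opX_add, opY_add,
      opX_contDiff, opY_contDiff, opZ_contDiff, opW_contDiff, contDiff_pi_add, contDiff_pi_sub,
      hc', hd']
    ring
end
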